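/- arXiv:2401.03299 — 2 statements merged into one kernel-verified Lean document; each statement's English description precedes it below -/
import Mathlib

section
/- Let β ∈ (0,1) and let i, k be integers with i ≤ k. Then Σ_{s=i}^{k} H_{β−1}(k, s−1)·H_{−β−1}(s, i−1) equals 0 if i < k, and equals 1 if i = k. Equivalently, for every integer m ≥ 1: Σ_{t=0}^{m} [Γ(m−t+β)/(Γ(m−t+1)·Γ(β))]·[Γ(t−β)/(Γ(t+1)·Γ(−β))] = 0. -/
/-- Nabla fractional Taylor monomial `H_γ(k,a)`. -/
noncomputable def H (γ : ℝ) (k a : ℤ) : ℝ :=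
  if 1 ≤ k - a then
    Real.Gamma ((k : ℝ) - (a : ℝ) + γ) / (Real.Gamma ((k : ℝ) - (a : ℝ)) * Real.Gamma (γ + 1))
  else 0

/-- Chu-Vandermonde identity for multichoose. -/
theorem Ring.multichoose_add {R : Type*} [CommRing R] [BinomialRing R] (r s : R) (n : ℕ) :
    multichoose (r + s) n =
      ∑ ij ∈ Finset.HasAntidiagonal.antidiagonal n, multichoose r ij.1 * multichoose s ij.2 := by
  have h := add_choose_eq n (Commute.all (-r) (-s))
  rw [← neg_add, choose_neg'] at h
  simp only [choose_neg'] at h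
  apply smul_left_cancel (Int.negOnePow n)
  rw [h, Finset.smul_sum]
  refine Finset.sum_congr rfl fun ij hij => ?_
  rw [smul_mul_smul_comm, ← Int.negOnePow_add, ← Nat.cast_add, Finset.HasAntidiagonal.mem_antidiagonal.mp hij]

theorem Real.Gamma_add_natCast (x : ℝ) (hx : ∀ m : ℕ, x ≠ -m) (n : ℕ) :
    Real.Gamma (x + n) = Real.Gamma x * (n.factorial * Ring.multichoose x n) := by
  rw [← nsmul_eq_mul, Ring.factorial_nsmul_multichoose_eq_ascPochhammer]
  induction n with
  | zero => simp
  | succ n ih =>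
    have hne : x + n ≠ 0 := fun h => hx n (by linarith)
    rw [ascPochhammer_succ_right, Polynomial.smeval_mul, Polynomial.smeval_add,
      Polynomial.smeval_X, Polynomial.smeval_natCast, Nat.cast_succ, ← add_assoc,
      Real.Gamma_add_one hne, ih]
    simp
    ring

theorem H_eq_multichoose {γ : ℝ} (hγ : ∀ m : ℕ, γ + 1 ≠ -m) {k a : ℤ} {n : ℕ}
    (hn : k - a = n + 1) : H γ k a = Ring.multichoose (γ + 1) n := by
  have hka : (k : ℝ) - a = n + 1 := by exact_mod_cast hn
  rw [H, if_pos (by lia), hka, Real.Gamma_nat_eq_factorial,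
    show (n : ℝ) + 1 + γ = γ + 1 + n by ring, Real.Gamma_add_natCast _ hγ]
  have hΓ := Real.Gamma_ne_zero hγ
  have hf : (n.factorial : ℝ) ≠ 0 := by exact_mod_cast n.factorial_ne_zero
  field_simp

/-- `Σ_{s=i}^{k} H_{β-1}(k, s-1)·H_{-β-1}(s, i-1)` equals `0` if `i < k` and `1` if `i = k`. -/
theorem sum_taylor_monomial_convolution (β : ℝ) (hβ0 : 0 < β) (hβ1 : β < 1)
    (i k : ℤ) (hik : i ≤ k) :
    ∑ s ∈ Finset.Icc i k, H (β - 1) k (s - 1) * H (-β - 1) s (i - 1)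
      = if i = k then (1 : ℝ) else 0 := by
  obtain ⟨n, rfl⟩ := Int.le.dest hik
  have hpos (m : ℕ) : β - 1 + 1 ≠ -m := by
    have := m.cast_nonneg (α := ℝ)
    intro h
    linarith
  have hneg (m : ℕ) : -β - 1 + 1 ≠ -m := by
    intro h
    have hβ : β = m := by linarith
    rw [hβ] at hβ0 hβ1
    norm_cast at hβ0 hβ1
    lia
  have hsum : ∑ s ∈ Finset.Icc i (i + n), H (β - 1) (i + n) (s - 1) * H (-β - 1) s (i - 1) =
      ∑ ij ∈ Finset.HasAntidiagonal.antidiagonal n,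
        Ring.multichoose (β - 1 + 1) ij.1 * Ring.multichoose (-β - 1 + 1) ij.2 := by
    symm
    refine Finset.sum_bij' (fun ij _ => i + ij.2)
      (fun s _ => ((i + n - s).toNat, (s - i).toNat)) ?_ ?_ ?_ ?_ ?_
    · simp only [Finset.HasAntidiagonal.mem_antidiagonal, Finset.mem_Icc]; lia
    · simp only [Finset.HasAntidiagonal.mem_antidiagonal, Finset.mem_Icc]; lia
    · simp only [Finset.HasAntidiagonal.mem_antidiagonal, Prod.ext_iff]; lia
    · simp only [Finset.mem_Icc]; lia
    · intro ij hij
      rw [Finset.HasAntidiagonal.mem_antidiagonal] at hij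
      rw [H_eq_multichoose hpos (n := ij.1) (by lia), H_eq_multichoose hneg (n := ij.2) (by lia)]
  rw [hsum, ← Ring.multichoose_add, show β - 1 + 1 + (-β - 1 + 1) = 0 by ring]
  cases n with
  | zero => simp
  | succ n =>
    rw [Ring.multichoose_zero_succ, if_neg (by lia)]
end

section
/- Let β ∈ (0,1), let a ∈ ℤ, and let z be a function from the integers to ℝ^n. Then for every integer k ≥ a + 1, the composition of the nabla fractional sum of order β based at a with the nabla Riemann–Liouville fractional difference of order β based at a−1 satisfies ∇_a^{−β} (∇_{a−1}^{β} z)(k) = z(k) − H_{β−1}(k, a−1)·z(a); explicitly, Σ_{s=a+1}^{k} H_{β−1}(k, s−1) · ( Σ_{i=a}^{s} H_{−β−1}(s, i−1)·z(i) ) = z(k) − H_{β−1}(k, a−1)·z(a). -/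
lemma gamma_ratio_eq_choose (r : ℝ) (hr : ∀ m : ℕ, r + m ≠ 0) (m : ℕ) :
    Real.Gamma (r + m) / (Real.Gamma ((m : ℝ) + 1) * Real.Gamma r)
      = (-1) ^ m * Ring.choose (-r) m := by
  have hΓ : Real.Gamma r ≠ 0 := Real.Gamma_ne_zero fun m h => hr m (by rw [h]; ring)
  induction m with
  | zero => simp [hΓ]
  | succ m ih =>
    have hm : (m : ℝ) + 1 ≠ 0 := by positivity
    have hΓm : Real.Gamma ((m : ℝ) + 1) ≠ 0 := (Real.Gamma_pos_of_pos (by positivity)).ne'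
    have hstep : ((m : ℝ) + 1) * Ring.choose (-r) (m + 1) = Ring.choose (-r) m * (-r - m) := by
      rw [Ring.choose_eq_smul, Ring.choose_eq_smul, descPochhammer_succ_right,
        Polynomial.smeval_mul, Nat.factorial_succ]
      have hf : (m.factorial : ℝ) ≠ 0 := by positivity
      simp only [Polynomial.smeval_sub, Polynomial.smeval_X, Polynomial.smeval_natCast, pow_one,
        pow_zero, smul_eq_mul, nsmul_eq_mul, mul_one]
      push_cast
      field_simp
    have hc : Ring.choose (-r) (m + 1) = Ring.choose (-r) m * (-r - m) / (m + 1) := by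
      field_simp
      linarith
    push_cast
    rw [← add_assoc, Real.Gamma_add_one (hr m), Real.Gamma_add_one hm, hc, pow_succ]
    rw [div_eq_iff (mul_ne_zero hΓm hΓ)] at ih
    rw [ih]
    field_simp
    ring

lemma H_sub_one_eq_choose (r : ℝ) (hr : ∀ m : ℕ, r + m ≠ 0) (i : ℤ) (m : ℕ) :
    H (r - 1) (i + m) (i - 1) = (-1) ^ m * Ring.choose (-r) m := by
  rw [← gamma_ratio_eq_choose r hr m, H, if_pos (by omega)]
  push_cast
  ring_nf

lemma sum_H_mul_H (β : ℝ) (hβ0 : 0 < β) (hβ1 : β < 1) (i : ℤ) (m : ℕ) :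
    ∑ s ∈ Finset.Icc i (i + m), H (β - 1) (i + m) (s - 1) * H (-β - 1) s (i - 1)
      = if m = 0 then 1 else 0 := by
  have hpos : ∀ m : ℕ, β + m ≠ 0 := fun m => by positivity
  have hneg : ∀ m : ℕ, -β + m ≠ 0 := by
    intro m h
    have h1 : (m : ℝ) = β := by linarith
    rw [← h1] at hβ0 hβ1
    norm_cast at hβ0 hβ1
    omega
  have hsum : ∑ s ∈ Finset.Icc i (i + m), H (β - 1) (i + m) (s - 1) * H (-β - 1) s (i - 1)
      = ∑ p ∈ Finset.HasAntidiagonal.antidiagonal m,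
          (-1 : ℝ) ^ m * (Ring.choose (-β) p.1 * Ring.choose β p.2) := by
    refine (Finset.sum_bij' (fun (p : ℕ × ℕ) _ => i + (p.2 : ℤ))
      (fun (s : ℤ) _ => ((i + m - s).toNat, (s - i).toNat)) ?_ ?_ ?_ ?_ ?_).symm
    · rintro ⟨p, q⟩ h
      simp only [Finset.HasAntidiagonal.mem_antidiagonal, Finset.mem_Icc] at h ⊢
      omega
    · intro s h
      simp only [Finset.HasAntidiagonal.mem_antidiagonal, Finset.mem_Icc] at h ⊢
      omega
    · rintro ⟨p, q⟩ h
      simp only [Finset.HasAntidiagonal.mem_antidiagonal, Prod.mk.injEq] at h ⊢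
      omega
    · intro s h
      simp only [Finset.mem_Icc] at h ⊢
      omega
    · rintro ⟨p, q⟩ h
      simp only [Finset.HasAntidiagonal.mem_antidiagonal] at h ⊢
      have h2 : i + (m : ℤ) = i + q + p := by omega
      rw [h2, H_sub_one_eq_choose β hpos, H_sub_one_eq_choose (-β) hneg, neg_neg, ← h, pow_add]
      ring
  rw [hsum, ← Finset.mul_sum, ← Ring.add_choose_eq m (Commute.all _ _), neg_add_cancel,
    Ring.choose_zero_ite]
  split_ifs with h <;> simp [h]

/-- Composition of the nabla fractional sum of order `β` based at `a` with the nabla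
Riemann–Liouville fractional difference of order `β` based at `a - 1`:
`∇_a^{-β} (∇_{a-1}^{β} z)(k) = z(k) - H_{β-1}(k, a-1)·z(a)`. -/
theorem nabla_sum_comp_RL_difference {n : ℕ} (β : ℝ) (hβ0 : 0 < β) (hβ1 : β < 1)
    (a : ℤ) (z : ℤ → Fin n → ℝ) (k : ℤ) (hk : a + 1 ≤ k) :
    ∑ s ∈ Finset.Icc (a + 1) k,
        H (β - 1) k (s - 1) • (∑ i ∈ Finset.Icc a s, H (-β - 1) s (i - 1) • z i)
      = z k - H (β - 1) k (a - 1) • z a := by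
  have hext : ∑ s ∈ Finset.Icc a k,
        H (β - 1) k (s - 1) • (∑ i ∈ Finset.Icc a s, H (-β - 1) s (i - 1) • z i) = z k := by
    simp only [Finset.smul_sum, smul_smul]
    rw [Finset.sum_comm' (t' := Finset.Icc a k) (s' := fun i => Finset.Icc i k)
      (by intro x y; simp only [Finset.mem_Icc]; omega)]
    have hinner : ∀ i ∈ Finset.Icc a k,
        ∑ s ∈ Finset.Icc i k, (H (β - 1) k (s - 1) * H (-β - 1) s (i - 1)) • z i
          = if i = k then z i else 0 := by
      intro i hi
      obtain ⟨m, rfl⟩ := Int.le.dest (Finset.mem_Icc.mp hi).2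
      rw [← Finset.sum_smul, sum_H_mul_H β hβ0 hβ1]
      by_cases hm : m = 0 <;> simp [hm]
    rw [Finset.sum_congr rfl hinner, Finset.sum_ite_eq', if_pos]
    exact Finset.mem_Icc.mpr ⟨by omega, le_rfl⟩
  have hΓ : Real.Gamma (-β) ≠ 0 := by
    refine Real.Gamma_ne_zero fun m h => ?_
    have h1 : (m : ℝ) = β := by linarith
    rw [← h1] at hβ0 hβ1
    norm_cast at hβ0 hβ1
    omega
  have hone : H (-β - 1) a (a - 1) = 1 := by
    simp [H, hΓ]
  rw [← Finset.insert_Icc_add_one_left_eq_Icc (by omega : a ≤ k),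
    Finset.sum_insert (by simp)] at hext
  rw [Finset.Icc_self, Finset.sum_singleton, hone, one_smul] at hext
  exact eq_sub_of_add_eq' hext
end
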